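/- arXiv:math/0310387 — 2 statements merged into one kernel-verified Lean document; each statement's English description precedes it below -/
import Mathlib

section
/- The ring R[x₁,...,x₈]/(x₁²+...+x₈²) is an integral domain, and its field of fractions is isomorphic to R(x₁,...,x₇)(√(−(x₁²+...+x₇²))). -/
set_option maxHeartbeats 1000000
set_option synthInstance.maxHeartbeats 400000

open MvPolynomial Polynomial

/-- `A[X]/(p)` (seen through an isomorphism `P ≃ A[X]`) has fraction field `K[X]/(p)`, for `p` monic
and irreducible over `K = Frac A`. -/
theorem aux_frac {A P K : Type} [CommRing A] [IsDomain A] [CommRing P] [Field K] [Algebra A K]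
    [IsFractionRing A K] (e : P ≃+* A[X]) (s : P) (p : A[X]) (hs : e s = p) (hp : p.Monic)
    (q : K[X]) (hq : p.map (algebraMap A K) = q) (hirr : Irreducible q) :
    IsDomain (P ⧸ Ideal.span {s}) ∧
      Nonempty (FractionRing (P ⧸ Ideal.span {s}) ≃+* AdjoinRoot q) := by
  have : Fact (Irreducible q) := ⟨hirr⟩
  let φ : P →+* AdjoinRoot q :=
    ((AdjoinRoot.mk q).comp (Polynomial.mapRingHom (algebraMap A K))).comp e.toRingHom
  have hφ : ∀ x, φ x = AdjoinRoot.mk q ((e x).map (algebraMap A K)) := fun x => rfl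
  have hker : ∀ x, φ x = 0 ↔ x ∈ Ideal.span {s} := by
    intro x
    rw [hφ, AdjoinRoot.mk_eq_zero, ← hq,
      Polynomial.map_dvd_map _ (IsFractionRing.injective A K) hp, ← hs,
      Ideal.mem_span_singleton]
    exact map_dvd_iff e
  let ψ : (P ⧸ Ideal.span {s}) →+* AdjoinRoot q :=
    Ideal.Quotient.lift _ φ (fun x hx => (hker x).2 hx)
  have hψ : ∀ x, ψ (Ideal.Quotient.mk _ x) = φ x := fun x => rfl
  have hinj : Function.Injective ψ := by
    rw [injective_iff_map_eq_zero]
    intro a ha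
    obtain ⟨x, rfl⟩ := Ideal.Quotient.mk_surjective a
    rw [hψ, hker] at ha
    exact Ideal.Quotient.eq_zero_iff_mem.2 ha
  have hdom : IsDomain (P ⧸ Ideal.span {s}) := hinj.isDomain ψ
  refine ⟨hdom, ?_⟩
  let _ := ψ.toAlgebra
  have : FaithfulSMul (P ⧸ Ideal.span {s}) (AdjoinRoot q) :=
    (faithfulSMul_iff_algebraMap_injective _ _).2 hinj
  have : IsFractionRing (P ⧸ Ideal.span {s}) (AdjoinRoot q) := by
    refine IsFractionRing.of_field _ _ fun z => ?_
    obtain ⟨g, rfl⟩ := AdjoinRoot.mk_surjective z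
    obtain ⟨b, hb, h⟩ := IsLocalization.integerNormalization_spec (nonZeroDivisors A) g
    refine ⟨Ideal.Quotient.mk _ (e.symm (IsLocalization.integerNormalization (nonZeroDivisors A) g)),
      Ideal.Quotient.mk _ (e.symm (Polynomial.C b)), ?_⟩
    change _ = ψ _ / ψ _
    rw [hψ, hψ, hφ, hφ, e.apply_symm_apply, e.apply_symm_apply, h, Polynomial.map_C]
    have hb0 : algebraMap A K b ≠ 0 := IsFractionRing.to_map_ne_zero_of_mem_nonZeroDivisors hb
    have h0 : AdjoinRoot.mk q (Polynomial.C (algebraMap A K b)) ≠ 0 := by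
      rw [AdjoinRoot.mk_C]
      exact (_root_.map_ne_zero _).2 hb0
    rw [eq_div_iff h0, ← map_mul, mul_comm, ← Polynomial.smul_eq_C_mul, algebraMap_smul]
  exact ⟨(FractionRing.algEquiv (P ⧸ Ideal.span {s}) (AdjoinRoot q)).toRingEquiv⟩

theorem aux_irr : Irreducible (Polynomial.X ^ 2 +
          Polynomial.C (algebraMap (MvPolynomial (Fin 7) ℝ)
            (FractionRing (MvPolynomial (Fin 7) ℝ))
            (∑ i : Fin 7, MvPolynomial.X i ^ 2))) := by
  have hdeg : ∀ c : FractionRing (MvPolynomial (Fin 7) ℝ),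
      (Polynomial.X ^ 2 + Polynomial.C c).natDegree = 2 := fun c =>
    Polynomial.natDegree_X_pow_add_C
  apply Polynomial.irreducible_of_degree_le_three_of_not_isRoot
  · rw [hdeg]; decide
  intro r hr
  rw [Polynomial.IsRoot.def, Polynomial.eval_add, Polynomial.eval_pow, Polynomial.eval_X,
    Polynomial.eval_C] at hr
  have hint : IsIntegral (MvPolynomial (Fin 7) ℝ) r := by
    refine ⟨Polynomial.X ^ 2 + Polynomial.C (∑ i : Fin 7, MvPolynomial.X i ^ 2),
      Polynomial.monic_X_pow_add_C _ (by decide), ?_⟩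
    rw [Polynomial.eval₂_add, Polynomial.eval₂_X_pow, Polynomial.eval₂_C]
    exact hr
  obtain ⟨a, rfl⟩ := IsIntegrallyClosed.isIntegral_iff.1 hint
  rw [← map_pow, ← map_add] at hr
  have h0 := (IsFractionRing.to_map_eq_zero_iff).1 hr
  have h1 := congrArg (MvPolynomial.eval (fun _ => (1 : ℝ))) h0
  simp at h1
  nlinarith [sq_nonneg (MvPolynomial.eval (fun _ => (1 : ℝ)) a)]

theorem stmt4 :
    IsDomain (MvPolynomial (Fin 8) ℝ ⧸
      Ideal.span {(∑ i : Fin 8, MvPolynomial.X i ^ 2 : MvPolynomial (Fin 8) ℝ)}) ∧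
    Nonempty
      ((FractionRing (MvPolynomial (Fin 8) ℝ ⧸
          Ideal.span {(∑ i : Fin 8, MvPolynomial.X i ^ 2 : MvPolynomial (Fin 8) ℝ)})) ≃+*
        AdjoinRoot (Polynomial.X ^ 2 +
          Polynomial.C (algebraMap (MvPolynomial (Fin 7) ℝ)
            (FractionRing (MvPolynomial (Fin 7) ℝ))
            (∑ i : Fin 7, MvPolynomial.X i ^ 2)))) := by
  refine aux_frac (MvPolynomial.finSuccEquiv ℝ 7).toRingEquiv _
    (Polynomial.X ^ 2 + Polynomial.C (∑ i : Fin 7, MvPolynomial.X i ^ 2)) ?_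
    (Polynomial.monic_X_pow_add_C _ (by decide)) _ ?_ aux_irr
  · change MvPolynomial.finSuccEquiv ℝ 7 _ = _
    rw [Fin.sum_univ_succ, map_add, map_pow, MvPolynomial.finSuccEquiv_X_zero, map_sum, map_sum]
    congr 1
    refine Finset.sum_congr rfl fun i _ => ?_
    rw [map_pow, MvPolynomial.finSuccEquiv_X_succ, map_pow]
  · rw [Polynomial.map_add, Polynomial.map_pow, Polynomial.map_X, Polynomial.map_C]
end

section
/- In the ring S = R[x₁,...,x₈]/(‖X‖²): if a is an 8×5 matrix over S with a·aᵗ = 0, then there exist u ∈ S⁸ and q ∈ S⁵ with a = u·qᵗ. -/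
theorem nag_ufd {B T : Type*} [CommRing B] [IsDomain B] [CommRing T] [IsDomain T]
    [UniqueFactorizationMonoid B] [WfDvdMonoid T] (f : B →+* T) (hf : Function.Injective f)
    (u : B) (hu : Prime (f u))
    (hloc : ∀ t : T, ∃ (n : ℕ) (b : B), f u ^ n * t = f b) : UniqueFactorizationMonoid T := by
  rw [UniqueFactorizationMonoid.iff_exists_prime_mem_of_isPrime]
  intro P hP0 hP
  by_cases huP : f u ∈ P
  · exact ⟨_, huP, hu⟩
  have hpow : ∀ n (t : T), f u ^ n * t ∈ P → t ∈ P := fun n t h =>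
    (hP.mem_or_mem h).resolve_left fun h' => huP (hP.mem_of_pow_mem _ h')
  have hcom : P.comap f ≠ ⊥ := by
    obtain ⟨t, htP, ht0⟩ := Submodule.exists_mem_ne_zero_of_ne_bot hP0
    obtain ⟨n, b, hb⟩ := hloc t
    intro hbot
    have hbm : b ∈ P.comap f := by
      rw [Ideal.mem_comap, ← hb]; exact P.mul_mem_left _ htP
    rw [hbot] at hbm
    have : b = 0 := hbm
    rw [this, map_zero] at hb
    rcases mul_eq_zero.1 hb with h | h
    · exact pow_ne_zero n hu.ne_zero h
    · exact ht0 h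
  have hcp : (P.comap f).IsPrime := Ideal.IsPrime.comap f
  obtain ⟨p, hpP, hp⟩ := hcp.exists_mem_prime_of_ne_bot hcom
  have hfp0 : f p ≠ 0 := by
    rw [Ne, map_eq_zero_iff f hf]; exact hp.ne_zero
  obtain ⟨k, p', hp'u, hpp'⟩ := WfDvdMonoid.max_power_factor hfp0 hu.irreducible
  have hp'P : p' ∈ P := hpow k _ (by rw [← hpp']; exact hpP)
  have hpu : ¬ p ∣ u := fun ⟨r, hr⟩ => huP (by
    rw [hr, map_mul]; exact P.mul_mem_right _ hpP)
  have key : ∀ (s : T) (n : ℕ), p' ∣ f u ^ n * s → p' ∣ s := by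
    intro s n ⟨y, hy⟩
    have h1 : f u ^ n ∣ p' * y := ⟨s, hy.symm⟩
    obtain ⟨z, rfl⟩ := hu.pow_dvd_of_dvd_mul_left n hp'u h1
    refine ⟨z, mul_left_cancel₀ (pow_ne_zero n hu.ne_zero) ?_⟩
    rw [hy]; ring
  have key2 : ∀ b : B, p ∣ b → p' ∣ f b := by
    rintro b ⟨r, rfl⟩
    rw [map_mul, hpp']
    exact ⟨f u ^ k * f r, by ring⟩
  refine ⟨p', hp'P, ?_, ?_, ?_⟩
  · rintro rfl; simp at hp'u
  · intro h; exact hP.ne_top (Ideal.eq_top_of_isUnit_mem _ hp'P h)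
  · rintro s t ⟨w, hw⟩
    obtain ⟨n, b, hb⟩ := hloc s
    obtain ⟨m, c, hc⟩ := hloc t
    obtain ⟨l, d, hd⟩ := hloc w
    have h1 : p ∣ u ^ (k + l) * (b * c) := by
      refine ⟨u ^ (n + m) * d, hf ?_⟩
      simp only [map_mul, map_pow]
      rw [← hb, ← hc, ← hd, hpp']
      calc _ = f u ^ (k + l + n + m) * (s * t) := by ring
        _ = _ := by rw [hw]; ring
    have h2 : p ∣ b * c := (hp.dvd_or_dvd h1).resolve_left fun h => hpu (hp.dvd_of_dvd_pow h)
    rcases hp.dvd_or_dvd h2 with h | h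
    · left; exact key s n (hb ▸ key2 b h)
    · right; exact key t m (hc ▸ key2 c h)

theorem nag_unit {B T : Type*} [CommRing B] [IsDomain B] [CommRing T] [IsDomain T]
    (f : B →+* T) (hf : Function.Injective f)
    (u : B) (huB : Prime u) (hu : Prime (f u))
    (hloc : ∀ t : T, ∃ (n : ℕ) (b : B), f u ^ n * t = f b) (t : T) (ht : IsUnit t) :
    ∃ c : B, IsUnit c ∧ f c = t := by
  obtain ⟨s, hs⟩ := ht.exists_right_inv
  obtain ⟨n, b, hb⟩ := hloc t
  obtain ⟨m, c, hc⟩ := hloc s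
  have h1 : b * c = u ^ (n + m) := hf (by
    rw [map_mul, ← hb, ← hc, map_pow]
    calc _ = f u ^ (n + m) * (t * s) := by ring
      _ = _ := by rw [hs, mul_one])
  obtain ⟨j, -, hj⟩ := (dvd_prime_pow huB _).1 (Dvd.intro _ h1)
  obtain ⟨v, hv⟩ := hj.symm
  rw [← hv, map_mul, map_pow] at hb
  have hvu : IsUnit (f v) := v.isUnit.map f
  rcases lt_trichotomy j n with h | h | h
  · exfalso
    obtain ⟨d, rfl⟩ := Nat.exists_eq_add_of_lt h
    have : f u * (f u ^ d * t) = f v := mul_left_cancel₀ (pow_ne_zero j hu.ne_zero) (by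
      rw [← hb]; ring)
    rw [← this] at hvu
    exact hu.not_isUnit (isUnit_of_mul_isUnit_left hvu)
  · subst h
    exact ⟨v, v.isUnit, (mul_left_cancel₀ (pow_ne_zero j hu.ne_zero) hb).symm⟩
  · exfalso
    obtain ⟨d, rfl⟩ := Nat.exists_eq_add_of_lt h
    have : t = f u * (f u ^ d * f v) := mul_left_cancel₀ (pow_ne_zero n hu.ne_zero) (by
      rw [hb]; ring)
    rw [this] at ht
    exact hu.not_isUnit (isUnit_of_mul_isUnit_left ht)

section
open ComplexConjugate
variable {T : Type*} [CommRing T] [IsDomain T] [UniqueFactorizationMonoid T] [Algebra ℂ T]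

theorem aniso_pair (σ : T →+* T) (hσ : ∀ t, σ (σ t) = t)
    (hc : ∀ z : ℂ, σ (algebraMap ℂ T z) = algebraMap ℂ T (conj z))
    (hU : ∀ t : T, IsUnit t → ∃ z : ℂ, algebraMap ℂ T z = t)
    (α β : T) (h : α * σ α + β * σ β = 0) : α = 0 := by
  by_contra hα
  have hinj : Function.Injective σ := fun x y hxy => by rw [← hσ x, hxy, hσ]
  obtain ⟨a, b, c, hab, rfl, rfl⟩ := UniqueFactorizationMonoid.exists_reduced_factors α hα β
  have hc0 : c ≠ 0 := left_ne_zero_of_mul hα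
  have ha0 : a ≠ 0 := right_ne_zero_of_mul hα
  have hσc : σ c ≠ 0 := by rwa [Ne, map_eq_zero_iff σ hinj]
  have hσa : σ a ≠ 0 := by rwa [Ne, map_eq_zero_iff σ hinj]
  have h1 : a * σ a + b * σ b = 0 := by
    refine mul_left_cancel₀ (mul_ne_zero hc0 hσc) ?_
    rw [mul_zero, ← h, map_mul, map_mul]; ring
  have hab' : IsRelPrime (σ b) (σ a) := by
    intro d hd1 hd2
    have : IsUnit (σ d) := hab (by simpa [hσ] using map_dvd σ hd2) (by simpa [hσ] using map_dvd σ hd1)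
    simpa [hσ] using this.map σ
  have h2 : a ∣ σ b := hab.dvd_of_dvd_mul_left ⟨-σ a, by linear_combination h1⟩
  have h3 : σ b ∣ a := hab'.dvd_of_dvd_mul_right ⟨-b, by linear_combination h1⟩
  obtain ⟨w, hw⟩ := associated_of_dvd_dvd h2 h3
  obtain ⟨z, hz⟩ := hU w w.isUnit
  have hb : b = σ a * algebraMap ℂ T (conj z) := by
    rw [← hσ b, ← hw, map_mul, ← hz, hc]
  have h4 : (a * σ a) * algebraMap ℂ T (1 + conj z * z) = 0 := by
    rw [← hw, ← hz] at h1
    rw [map_add, map_one, map_mul]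
    rw [hb] at h1
    linear_combination h1
  have h5 := (mul_eq_zero.1 h4).resolve_left (mul_ne_zero ha0 hσa)
  rw [map_eq_zero_iff _ (algebraMap ℂ T).injective] at h5
  have := congrArg Complex.re h5
  simp at this
  nlinarith [mul_self_nonneg z.re, mul_self_nonneg z.im]

theorem aniso4 (σ : T →+* T) (hσ : ∀ t, σ (σ t) = t)
    (hc : ∀ z : ℂ, σ (algebraMap ℂ T z) = algebraMap ℂ T (conj z))
    (hU : ∀ t : T, IsUnit t → ∃ z : ℂ, algebraMap ℂ T z = t)
    (p q r s : T) (hp : σ p = p) (hq : σ q = q) (hr : σ r = r) (hs : σ s = s)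
    (h : p * p + q * q + r * r + s * s = 0) : p = 0 := by
  set I : T := algebraMap ℂ T Complex.I with hI
  have hII : I * I = -1 := by rw [hI, ← map_mul]; simp
  have hσI : σ I = -I := by rw [hI, hc]; simp
  have h0 := aniso_pair σ hσ hc hU (p + I * q) (r + I * s) (by
    simp only [map_add, map_mul, hp, hq, hr, hs, hσI]
    linear_combination h - (q * q + s * s) * hII)
  have h1 : p - I * q = 0 := by
    have := congrArg σ h0
    simp only [map_add, map_mul, hp, hq, hσI, map_zero] at this
    linear_combination this
  have h2 : algebraMap ℂ T 2 * p = 0 := by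
    rw [map_ofNat]; linear_combination h0 + h1
  refine (mul_eq_zero.1 h2).resolve_left ?_
  rw [map_eq_zero_iff _ (algebraMap ℂ T).injective]
  norm_num

theorem aniso5 (σ : T →+* T) (hσ : ∀ t, σ (σ t) = t)
    (hc : ∀ z : ℂ, σ (algebraMap ℂ T z) = algebraMap ℂ T (conj z))
    (hU : ∀ t : T, IsUnit t → ∃ z : ℂ, algebraMap ℂ T z = t)
    (v : Fin 5 → T) (hv : ∀ s, σ (v s) = v s) (h : ∑ s, v s * v s = 0) (s : Fin 5) (hs : v s = 0)
    (t : Fin 5) : v t = 0 := by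
  have A := aniso4 σ hσ hc hU
  rw [Fin.sum_univ_five] at h
  have B : ∀ i j k l : Fin 5, v i * v i + v j * v j + v k * v k + v l * v l = 0 → 
      v i = 0 ∧ v j = 0 ∧ v k = 0 ∧ v l = 0 := by
    intro i j k l h
    refine ⟨A _ _ _ _ (hv i) (hv j) (hv k) (hv l) h, A _ _ _ _ (hv j) (hv i) (hv k) (hv l) ?_,
      A _ _ _ _ (hv k) (hv i) (hv j) (hv l) ?_, A _ _ _ _ (hv l) (hv i) (hv j) (hv k) ?_⟩ <;>
    linear_combination h
  fin_cases s <;> simp only [Fin.zero_eta, Fin.mk_one, Fin.reduceFinMk] at hs <;> rw [hs] at h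
  · have := B 1 2 3 4 (by linear_combination h)
    fin_cases t <;> simp [hs, this]
  · have := B 0 2 3 4 (by linear_combination h)
    fin_cases t <;> simp [hs, this]
  · have := B 0 1 3 4 (by linear_combination h)
    fin_cases t <;> simp [hs, this]
  · have := B 0 1 2 4 (by linear_combination h)
    fin_cases t <;> simp [hs, this]
  · have := B 0 1 2 3 (by linear_combination h)
    fin_cases t <;> simp [hs, this]

theorem minors (σ : T →+* T) (hσ : ∀ t, σ (σ t) = t)
    (hc : ∀ z : ℂ, σ (algebraMap ℂ T z) = algebraMap ℂ T (conj z))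
    (hU : ∀ t : T, IsUnit t → ∃ z : ℂ, algebraMap ℂ T z = t)
    (b : Fin 8 → Fin 5 → T) (hb : ∀ i s, σ (b i s) = b i s)
    (h : ∀ i j, ∑ s, b i s * b j s = 0) (i j : Fin 8) (s t : Fin 5) :
    b i s * b j t = b j s * b i t := by
  have := aniso5 σ hσ hc hU (fun t => b i s * b j t - b j s * b i t) (by simp [hb]) (by
    have e : ∀ t, (b i s * b j t - b j s * b i t) * (b i s * b j t - b j s * b i t) =
      b i s * b i s * (b j t * b j t) - 2 * b i s * b j s * (b i t * b j t)
        + b j s * b j s * (b i t * b i t) := fun t => by ring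
    simp only [e, Finset.sum_add_distrib, Finset.sum_sub_distrib, ← Finset.mul_sum, h]
    simp) s (by ring) t
  exact sub_eq_zero.1 this

theorem prim_dvd [NormalizedGCDMonoid T] (q : Fin 5 → T) (hq : Finset.univ.gcd q = 1) (x y : T)
    (h : ∀ t, x ∣ y * q t) : x ∣ y := by
  have h1 : x ∣ Finset.univ.gcd (fun t => y * q t) := Finset.dvd_gcd fun t _ => h t
  have h2 := h1.trans (Finset.gcd_mul_left' Finset.univ q y).dvd
  rwa [hq, mul_one] at h2

theorem factor (σ : T →+* T) (hσ : ∀ t, σ (σ t) = t)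
    (hc : ∀ z : ℂ, σ (algebraMap ℂ T z) = algebraMap ℂ T (conj z))
    (hU : ∀ t : T, IsUnit t → ∃ z : ℂ, algebraMap ℂ T z = t)
    (b : Fin 8 → Fin 5 → T) (hb : ∀ i s, σ (b i s) = b i s)
    (h : ∀ i j s t, b i s * b j t = b j s * b i t) :
    ∃ (u : Fin 8 → T) (q : Fin 5 → T), (∀ i, σ (u i) = u i) ∧ (∀ s, σ (q s) = q s) ∧
      ∀ i s, b i s = u i * q s := by
  classical
  by_cases hz : ∀ i s, b i s = 0
  · exact ⟨0, 0, by simp, by simp, by simpa using hz⟩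
  push Not at hz
  obtain ⟨i₀, s₀, h0⟩ := hz
  let _ : StrongNormalizationMonoid T := UniqueFactorizationMonoid.strongNormalizationMonoid
  let _ : NormalizedGCDMonoid T := UniqueFactorizationMonoid.toNormalizedGCDMonoid T
  obtain ⟨q, hq, hq1⟩ := Finset.extract_gcd (b i₀) (Finset.univ_nonempty (α := Fin 5))
  set d := Finset.univ.gcd (b i₀)
  replace hq : ∀ s, b i₀ s = d * q s := fun s => hq s (Finset.mem_univ s)
  have hd : d ≠ 0 := left_ne_zero_of_mul (hq s₀ ▸ h0)
  have hq0 : q s₀ ≠ 0 := right_ne_zero_of_mul (hq s₀ ▸ h0)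
  have hinj : Function.Injective σ := fun x y hxy => by rw [← hσ x, hxy, hσ]
  have hσd : σ d ≠ 0 := by rwa [Ne, map_eq_zero_iff σ hinj]
  -- generic division
  have div : ∀ y : Fin 5 → T, (∀ s t, y s * q t = y t * q s) → ∃ w, ∀ s, y s = w * q s := by
    intro y hy
    obtain ⟨w, hw⟩ : q s₀ ∣ y s₀ := prim_dvd q hq1 _ _ fun t => ⟨y t, by rw [hy]; ring⟩
    refine ⟨w, fun s => mul_right_cancel₀ hq0 ?_⟩
    rw [hy, hw]; ring
  have hu : ∀ i, ∃ w, ∀ s, b i s = w * q s := fun i => div _ fun s t => by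
    refine mul_left_cancel₀ hd ?_
    have := h i i₀ s t
    rw [hq, hq] at this
    linear_combination this
  choose u hu using hu
  obtain ⟨c, hcq⟩ := div (fun s => σ (q s)) fun s t => by
    refine mul_left_cancel₀ (mul_ne_zero hd hσd) ?_
    have e : ∀ s, σ d * σ (q s) = d * q s := fun s => by
      rw [← map_mul, ← hq, hb]
    linear_combination d * q t * e s - d * q s * e t
  have hcc : σ c * c = 1 := mul_right_cancel₀ hq0 (by
    have := hσ (q s₀)
    rw [hcq, map_mul, hcq] at this
    linear_combination this)
  obtain ⟨z, hz⟩ := hU c (IsUnit.of_mul_eq_one _ ((mul_comm _ _).trans hcc))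
  have hzz : conj z * z = 1 := by
    apply (algebraMap ℂ T).injective
    rw [map_mul, ← hc, hz, hcc, map_one]
  obtain ⟨l, hl⟩ := IsAlgClosed.exists_pow_nat_eq z (n := 2) (by norm_num)
  have hll : conj l * l = 1 := by
    have h1 : ‖z‖ = 1 := by
      have := congrArg norm hzz
      rw [norm_mul, RCLike.norm_conj, norm_one] at this
      nlinarith [norm_nonneg z]
    have h2 : ‖l‖ ^ 2 = 1 := by rw [← norm_pow, hl, h1]
    rw [Complex.conj_mul', ← Complex.ofReal_pow, h2]; simp
  set A := algebraMap ℂ T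
  have hll' : A (conj l) * A l = 1 := by rw [← map_mul, hll, map_one]
  have hlz : A l * A l = c := by rw [← hz, ← map_mul, ← hl, sq]
  have hqf : ∀ s, σ (A l * q s) = A l * q s := fun s => by
    rw [map_mul, hc, hcq, ← hlz]
    linear_combination A l * q s * hll'
  have hbf : ∀ i s, b i s = (A (conj l) * u i) * (A l * q s) := fun i s => by
    rw [hu]; linear_combination -(u i * q s) * hll'
  refine ⟨fun i => A (conj l) * u i, fun s => A l * q s, fun i => ?_, hqf, hbf⟩
  have hne : A l * q s₀ ≠ 0 := mul_ne_zero (right_ne_zero_of_mul_eq_one hll') hq0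
  refine mul_right_cancel₀ hne ?_
  have := hb i s₀
  rw [hbf, map_mul, hqf] at this
  exact this
end

section
open MvPolynomial

/-- The split quadratic form in eight variables. -/
noncomputable def splitD : MvPolynomial (Fin 4 ⊕ Fin 4) ℂ := ∑ k : Fin 4, X (.inl k) * X (.inr k)

/-- The split quadratic form in the last six variables. -/
noncomputable def splitQ : MvPolynomial (Fin 4 ⊕ Fin 4) ℂ :=
  ∑ k : Fin 3, X (.inl k.succ) * X (.inr k.succ)

theorem splitD_eq : splitD = X (.inl 0) * X (.inr 0) + splitQ := by
  rw [splitD, splitQ, Fin.sum_univ_succ]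

theorem prime_of_coeffs (c : Fin 4 → ℂ) (h1 : c 1 = 1) (h2 : c 2 = 1) :
    Prime (∑ k : Fin 4, c k • (X (.inl k) * X (.inr k)) : MvPolynomial (Fin 4 ⊕ Fin 4) ℂ) := by
  have := irreducible_sumSMulXSMulY (R := ℂ) (Finsupp.equivFunOnFinite.symm c)
    ⟨1, by simp [h1], 2, by simp [h2], by decide⟩ (fun r hr => by
      have := hr 1
      simp only [Finsupp.equivFunOnFinite_symm_apply_apply, h1] at this
      exact isUnit_of_dvd_one this)
  rw [sumSMulXSMulY, Finsupp.linearCombination_apply, Finsupp.sum_fintype _ _ (by simp)] at this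
  simpa using this.prime

theorem splitD_prime : Prime splitD := by
  simpa [splitD] using prime_of_coeffs 1 rfl rfl

theorem splitQ_prime : Prime splitQ := by
  have := prime_of_coeffs (Fin.cons 0 1) rfl rfl
  rw [Fin.sum_univ_succ] at this
  simpa [splitQ] using this

/-- The complex quadric cone, in split coordinates. -/
abbrev SplitT : Type := MvPolynomial (Fin 4 ⊕ Fin 4) ℂ ⧸ Ideal.span {splitD}

instance splitT_domain : IsDomain SplitT := by
  have : (Ideal.span {splitD}).IsPrime :=
    (Ideal.span_singleton_prime splitD_prime.ne_zero).2 splitD_prime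
  exact Ideal.Quotient.isDomain _

/-- Variables different from the last isotropic one. -/
abbrev SplitJ : Type := {j : Fin 4 ⊕ Fin 4 // j ≠ .inr 0}

/-- Embedding of the polynomial ring in seven variables. -/
noncomputable def splitF : MvPolynomial SplitJ ℂ →+* SplitT :=
  (Ideal.Quotient.mk _).comp (rename (R := ℂ) (Subtype.val : SplitJ → _)).toRingHom

/-- The inverted variable. -/
noncomputable def splitU : MvPolynomial SplitJ ℂ := X ⟨.inl 0, by simp⟩

/-- The six variable form in the smaller ring. -/
noncomputable def splitQB : MvPolynomial SplitJ ℂ :=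
  ∑ k : Fin 3, X ⟨.inl k.succ, by simp⟩ * X ⟨.inr k.succ, by simp⟩

theorem splitQB_rename : rename (Subtype.val : SplitJ → _) splitQB = splitQ := by
  simp [splitQB, splitQ]

theorem splitF_U : splitF splitU = Ideal.Quotient.mk _ (X (.inl 0)) := by
  simp [splitF, splitU]

theorem splitF_inj : Function.Injective splitF := by
  rw [injective_iff_map_eq_zero]
  intro p hp
  let L := FractionRing (MvPolynomial SplitJ ℂ)
  let A : MvPolynomial SplitJ ℂ →ₐ[ℂ] L := IsScalarTower.toAlgHom ℂ _ L
  have hA : Function.Injective A := IsFractionRing.injective (MvPolynomial SplitJ ℂ) L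
  let θ : MvPolynomial (Fin 4 ⊕ Fin 4) ℂ →ₐ[ℂ] L :=
    aeval (fun j => if h : j ≠ .inr 0 then A (X ⟨j, h⟩) else - A splitQB / A splitU)
  have h1 : θ.comp (rename Subtype.val) = A := by
    ext j
    simp [θ, j.2]
  have h1' : ∀ p, θ (rename Subtype.val p) = A p := fun p => DFunLike.congr_fun h1 p
  have hU : A splitU ≠ 0 := by
    rw [Ne, map_eq_zero_iff A hA]; exact X_ne_zero _
  have h2 : θ splitD = 0 := by
    rw [splitD_eq, map_add, map_mul, ← splitQB_rename, h1']
    have e1 : θ (X (.inl 0)) = A splitU := by simp [θ, splitU]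
    have e2 : θ (X (.inr 0)) = - A splitQB / A splitU := by simp [θ]
    rw [e1, e2, mul_div_cancel₀ _ hU, neg_add_cancel]
  have h3 : rename Subtype.val p ∈ Ideal.span {splitD} := Ideal.Quotient.eq_zero_iff_mem.1 hp
  obtain ⟨g, hg⟩ := Ideal.mem_span_singleton.1 h3
  have := congrArg θ hg
  rw [h1', map_mul, h2, zero_mul] at this
  exact (map_eq_zero_iff A hA).1 this

theorem splitU_prime : Prime (splitF splitU) := by
  refine ⟨?_, ?_, ?_⟩
  · rw [Ne, map_eq_zero_iff _ splitF_inj]; exact X_ne_zero _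
  · rw [splitF_U]
    intro h
    obtain ⟨s, hs⟩ := h.exists_right_inv
    obtain ⟨s, rfl⟩ := Ideal.Quotient.mk_surjective s
    rw [← map_mul, ← map_one (Ideal.Quotient.mk _), Ideal.Quotient.eq,
      Ideal.mem_span_singleton] at hs
    obtain ⟨g, hg⟩ := hs
    have := congrArg constantCoeff hg
    simp [splitD] at this
  · intro s t
    obtain ⟨s, rfl⟩ := Ideal.Quotient.mk_surjective s
    obtain ⟨t, rfl⟩ := Ideal.Quotient.mk_surjective t
    rw [splitF_U]
    rintro ⟨w, hw⟩
    obtain ⟨w, rfl⟩ := Ideal.Quotient.mk_surjective w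
    rw [← map_mul, ← map_mul, Ideal.Quotient.eq, Ideal.mem_span_singleton] at hw
    obtain ⟨g, hg⟩ := hw
    let ev : MvPolynomial (Fin 4 ⊕ Fin 4) ℂ →ₐ[ℂ] MvPolynomial (Fin 4 ⊕ Fin 4) ℂ :=
      aeval (fun j => if j = .inl 0 then 0 else X j)
    have hev0 : ev (X (.inl 0)) = 0 := by simp [ev]
    have hevQ : ev splitQ = splitQ := by simp [ev, splitQ]
    have hev : ∀ p, X (.inl 0) ∣ p - ev p := by
      intro p
      induction p using MvPolynomial.induction_on with
      | C a => simp [ev]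
      | add p q hp hq =>
        rw [map_add, add_sub_add_comm]; exact dvd_add hp hq
      | mul_X p j hp =>
        rw [map_mul]
        by_cases hj : j = .inl 0
        · subst hj; rw [hev0]; simp
        · have : ev (X j) = X j := by simp [ev, hj]
          rw [this, ← sub_mul]; exact hp.mul_right _
    have h1 : splitQ ∣ ev s * ev t := by
      refine ⟨ev g, ?_⟩
      have := congrArg ev hg
      simp only [map_sub, map_mul, splitD_eq, map_add, hev0, hevQ] at this
      linear_combination this
    have fin : ∀ s, splitQ ∣ ev s → 
        (Ideal.Quotient.mk (Ideal.span {splitD})) (X (.inl 0)) ∣ Ideal.Quotient.mk _ s := by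
      rintro s ⟨y, hy⟩
      obtain ⟨z, hz⟩ := hev s
      refine ⟨Ideal.Quotient.mk _ (z - X (.inr 0) * y), ?_⟩
      rw [← map_mul, Ideal.Quotient.eq, Ideal.mem_span_singleton]
      refine ⟨y, ?_⟩
      rw [splitD_eq]
      linear_combination hz + hy
    rcases splitQ_prime.dvd_or_dvd h1 with h | h
    · exact .inl (fin _ h)
    · exact .inr (fin _ h)

theorem split_loc (t : SplitT) : ∃ (n : ℕ) (b : MvPolynomial SplitJ ℂ),
    splitF splitU ^ n * t = splitF b := by
  obtain ⟨p, rfl⟩ := Ideal.Quotient.mk_surjective t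
  induction p using MvPolynomial.induction_on with
  | C a => exact ⟨0, C a, by simp [splitF]⟩
  | add p q hp hq =>
    obtain ⟨n, b, hb⟩ := hp
    obtain ⟨m, c, hc⟩ := hq
    refine ⟨n + m, splitU ^ m * b + splitU ^ n * c, ?_⟩
    simp only [map_add, map_mul, map_pow, ← hb, ← hc]
    ring
  | mul_X p j hp =>
    obtain ⟨n, b, hb⟩ := hp
    by_cases hj : j = .inr 0
    · subst hj
      refine ⟨n + 1, - (b * splitQB), ?_⟩
      have h0 : Ideal.Quotient.mk (Ideal.span {splitD}) splitD = 0 :=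
        Ideal.Quotient.eq_zero_iff_mem.2 (Ideal.mem_span_singleton_self _)
      have h0 : Ideal.Quotient.mk (Ideal.span {splitD}) (X (.inl 0) * X (.inr 0) + splitQ) = 0 := by
        rw [← splitD_eq]; exact h0
      have hQ : splitF splitQB = Ideal.Quotient.mk _ splitQ := by
        rw [← splitQB_rename]; rfl
      rw [map_add, map_mul] at h0
      rw [map_neg, map_mul, map_mul, ← hb, hQ, splitF_U]
      linear_combination (Ideal.Quotient.mk (Ideal.span {splitD}) (X (.inl 0)) ^ n *
        Ideal.Quotient.mk (Ideal.span {splitD}) p) * h0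
    · refine ⟨n, b * X ⟨j, hj⟩, ?_⟩
      have : splitF (X ⟨j, hj⟩) = Ideal.Quotient.mk _ (X j) := by simp [splitF]
      rw [map_mul, map_mul, ← hb, this]; ring

theorem splitT_ufd : UniqueFactorizationMonoid SplitT :=
  nag_ufd splitF splitF_inj splitU splitU_prime split_loc

theorem splitT_unit (t : SplitT) (ht : IsUnit t) : ∃ z : ℂ, algebraMap ℂ SplitT z = t := by
  obtain ⟨c, hc, rfl⟩ := nag_unit splitF splitF_inj splitU (X_prime ..) splitU_prime split_loc t ht
  rw [isUnit_iff_eq_C_of_isReduced] at hc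
  obtain ⟨z, -, rfl⟩ := hc
  exact ⟨z, by simp [splitF]; rfl⟩

/-- The sum of squares. -/
noncomputable def cD : MvPolynomial (Fin 8) ℂ := ∑ i : Fin 8, X i ^ 2

/-- Change of coordinates. -/
noncomputable def chg : MvPolynomial (Fin 4 ⊕ Fin 4) ℂ ≃ₐ[ℂ] MvPolynomial (Fin 8) ℂ :=
  AlgEquiv.ofAlgHom
    (aeval (Sum.elim
      (fun k => X (finSumFinEquiv (m := 4) (n := 4) (.inl k)) +
        C Complex.I * X (finSumFinEquiv (m := 4) (n := 4) (.inr k)))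
      (fun k => X (finSumFinEquiv (m := 4) (n := 4) (.inl k)) -
        C Complex.I * X (finSumFinEquiv (m := 4) (n := 4) (.inr k)))))
    (aeval (fun i => Sum.elim
      (fun k => C (1 / 2) * (X (.inl k) + X (.inr k)))
      (fun k => C (-Complex.I / 2) * (X (.inl k) - X (.inr k)))
      ((finSumFinEquiv (m := 4) (n := 4)).symm i)))
    (by
      have h1 : (C Complex.I * C Complex.I : MvPolynomial (Fin 8) ℂ) = -1 := by
        rw [← C_mul]; simp
      have h2 : (C (1 / 2) * 2 : MvPolynomial (Fin 8) ℂ) = 1 := by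
        rw [← map_ofNat C 2, ← C_mul]; simp
      have h3 : (C (-Complex.I / 2) : MvPolynomial (Fin 8) ℂ) = - C Complex.I * C (1 / 2) := by
        rw [← C_neg, ← C_mul]; congr 1; ring
      apply algHom_ext
      intro i
      obtain ⟨i, rfl⟩ := (finSumFinEquiv (m := 4) (n := 4)).surjective i
      rcases i with k | k
      · simp only [AlgHom.comp_apply, aeval_X, Equiv.symm_apply_apply, Sum.elim_inl, Sum.elim_inr,
          map_mul, map_add, AlgHom.id_apply, algHom_C, algebraMap_eq]
        linear_combination X (finSumFinEquiv (m := 4) (n := 4) (.inl k)) * h2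
      · simp only [AlgHom.comp_apply, aeval_X, Equiv.symm_apply_apply, Sum.elim_inl, Sum.elim_inr,
          map_mul, map_sub, AlgHom.id_apply, algHom_C, algebraMap_eq, h3]
        linear_combination X (finSumFinEquiv (m := 4) (n := 4) (.inr k)) * h2 -
          2 * C (1 / 2) * X (finSumFinEquiv (m := 4) (n := 4) (.inr k)) * h1)
    (by
      have h1 : (C Complex.I * C Complex.I : MvPolynomial (Fin 4 ⊕ Fin 4) ℂ) = -1 := by
        rw [← C_mul]; simp
      have h2 : (C (1 / 2) * 2 : MvPolynomial (Fin 4 ⊕ Fin 4) ℂ) = 1 := by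
        rw [← map_ofNat C 2, ← C_mul]; simp
      have h3 : (C (-Complex.I / 2) : MvPolynomial (Fin 4 ⊕ Fin 4) ℂ) =
          - C Complex.I * C (1 / 2) := by
        rw [← C_neg, ← C_mul]; congr 1; ring
      apply algHom_ext
      rintro (k | k)
      · simp only [AlgHom.comp_apply, aeval_X, Equiv.symm_apply_apply, Sum.elim_inl, Sum.elim_inr,
          map_mul, map_add, AlgHom.id_apply, algHom_C, algebraMap_eq, h3]
        linear_combination X (.inl k) * h2 - C (1 / 2) * (X (.inl k) - X (.inr k)) * h1
      · simp only [AlgHom.comp_apply, aeval_X, Equiv.symm_apply_apply, Sum.elim_inl, Sum.elim_inr,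
          map_mul, map_sub, AlgHom.id_apply, algHom_C, algebraMap_eq, h3]
        linear_combination X (.inr k) * h2 + C (1 / 2) * (X (.inl k) - X (.inr k)) * h1)

theorem chg_D : chg splitD = cD := by
  have h1 : (C Complex.I * C Complex.I : MvPolynomial (Fin 8) ℂ) = -1 := by
    rw [← C_mul]; simp
  rw [splitD, cD, map_sum, ← (finSumFinEquiv (m := 4) (n := 4)).sum_comp, Fintype.sum_sum_type,
    ← Finset.sum_add_distrib]
  refine Finset.sum_congr rfl fun k _ => ?_
  simp only [chg, AlgEquiv.ofAlgHom_apply, map_mul, aeval_X, Sum.elim_inl, Sum.elim_inr]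
  linear_combination - X (finSumFinEquiv (m := 4) (n := 4) (.inr k)) ^ 2 * h1

/-- The complex cone. -/
abbrev CT : Type := MvPolynomial (Fin 8) ℂ ⧸ Ideal.span {cD}

/-- The two models agree. -/
noncomputable def chgT : SplitT ≃ₐ[ℂ] CT :=
  Ideal.quotientEquivAlg _ _ chg (by
    rw [Ideal.map_span, Set.image_singleton]; congr 2; exact chg_D.symm)

instance ct_domain : IsDomain CT := chgT.symm.toMulEquiv.isDomain _

instance ct_ufd : UniqueFactorizationMonoid CT :=
  have := splitT_ufd
  chgT.toMulEquiv.uniqueFactorizationMonoid this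

theorem ct_unit (t : CT) (ht : IsUnit t) : ∃ z : ℂ, algebraMap ℂ CT z = t := by
  obtain ⟨z, hz⟩ := splitT_unit (chgT.symm t) (ht.map chgT.symm)
  refine ⟨z, ?_⟩
  rw [← chgT.apply_symm_apply t, ← hz, AlgEquiv.commutes]

open ComplexConjugate

/-- The real sum of squares. -/
noncomputable def rD : MvPolynomial (Fin 8) ℝ := ∑ i : Fin 8, X i ^ 2

/-- The real cone. -/
abbrev RS : Type := MvPolynomial (Fin 8) ℝ ⧸ Ideal.span {rD}

theorem map_rD : map Complex.ofRealHom rD = cD := by simp [rD, cD]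

theorem conj_cD : map (starRingEnd ℂ) cD = cD := by simp [cD]

/-- Complexification. -/
noncomputable def rc : RS →+* CT :=
  Ideal.quotientMap _ (map Complex.ofRealHom) (by
    rw [Ideal.span_singleton_le_iff_mem, Ideal.mem_comap, map_rD]
    exact Ideal.mem_span_singleton_self _)

/-- Conjugation. -/
noncomputable def cj : CT →+* CT :=
  Ideal.quotientMap _ (map (starRingEnd ℂ)) (by
    rw [Ideal.span_singleton_le_iff_mem, Ideal.mem_comap, conj_cD]
    exact Ideal.mem_span_singleton_self _)

theorem cj_mk (p : MvPolynomial (Fin 8) ℂ) :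
    cj (Ideal.Quotient.mk _ p) = Ideal.Quotient.mk _ (map (starRingEnd ℂ) p) := rfl

theorem rc_mk (p : MvPolynomial (Fin 8) ℝ) :
    rc (Ideal.Quotient.mk _ p) = Ideal.Quotient.mk _ (map Complex.ofRealHom p) := rfl

theorem conj_real (p : MvPolynomial (Fin 8) ℝ) :
    map (starRingEnd ℂ) (map Complex.ofRealHom p) = map Complex.ofRealHom p := by
  rw [map_map]
  have : (starRingEnd ℂ).comp Complex.ofRealHom = Complex.ofRealHom := by
    apply RingHom.ext; intro x; simp
  rw [this]

theorem re_im (p : MvPolynomial (Fin 8) ℂ) : ∃ P Q : MvPolynomial (Fin 8) ℝ,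
    p = map Complex.ofRealHom P + C Complex.I * map Complex.ofRealHom Q := by
  induction p using MvPolynomial.induction_on with
  | C a =>
    refine ⟨C a.re, C a.im, ?_⟩
    simp only [map_C, Complex.ofRealHom_eq_coe, ← C_mul, ← C_add]
    rw [mul_comm, Complex.re_add_im]
  | add p q hp hq =>
    obtain ⟨P, Q, rfl⟩ := hp
    obtain ⟨P', Q', rfl⟩ := hq
    exact ⟨P + P', Q + Q', by simp only [map_add]; ring⟩
  | mul_X p j hp =>
    obtain ⟨P, Q, rfl⟩ := hp
    exact ⟨P * X j, Q * X j, by simp only [map_mul, map_X]; ring⟩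

theorem re_im_zero (P Q : MvPolynomial (Fin 8) ℝ)
    (h : map Complex.ofRealHom P + C Complex.I * map Complex.ofRealHom Q = 0) : P = 0 := by
  have h' := congrArg (map (starRingEnd ℂ)) h
  simp only [map_add, map_mul, conj_real, map_C, Complex.conj_I, map_zero, C_neg] at h'
  have h2 : (C (1 / 2) * 2 : MvPolynomial (Fin 8) ℂ) = 1 := by
    rw [← map_ofNat C 2, ← C_mul]; simp
  have : map Complex.ofRealHom P = 0 := by
    linear_combination C (1 / 2) * (h + h') - map Complex.ofRealHom P * h2
  exact (map_eq_zero_iff _ (map_injective _ Complex.ofRealHom.injective)).1 this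

theorem rc_inj : Function.Injective rc := by
  rw [injective_iff_map_eq_zero]
  intro p hp
  obtain ⟨p, rfl⟩ := Ideal.Quotient.mk_surjective p
  rw [rc_mk, Ideal.Quotient.eq_zero_iff_mem, Ideal.mem_span_singleton] at hp
  obtain ⟨g, hg⟩ := hp
  obtain ⟨P, Q, rfl⟩ := re_im g
  rw [Ideal.Quotient.eq_zero_iff_mem, Ideal.mem_span_singleton]
  refine ⟨P, sub_eq_zero.1 (re_im_zero _ (-(rD * Q)) ?_)⟩
  rw [← map_rD] at hg
  simp only [map_sub, map_mul, map_neg]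
  linear_combination hg

theorem rc_fixed (t : CT) (ht : cj t = t) : ∃ s, rc s = t := by
  obtain ⟨p, rfl⟩ := Ideal.Quotient.mk_surjective t
  obtain ⟨P, Q, rfl⟩ := re_im p
  refine ⟨Ideal.Quotient.mk _ P, ?_⟩
  have h2 : (C (1 / 2) * 2 : MvPolynomial (Fin 8) ℂ) = 1 := by
    rw [← map_ofNat C 2, ← C_mul]; simp
  rw [cj_mk, Ideal.Quotient.eq, Ideal.mem_span_singleton] at ht
  obtain ⟨g, hg⟩ := ht
  simp only [map_add, map_mul, conj_real, map_C, Complex.conj_I, map_zero, C_neg] at hg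
  rw [rc_mk, Ideal.Quotient.eq, Ideal.mem_span_singleton]
  refine ⟨C (1 / 2) * g, ?_⟩
  linear_combination C (1 / 2) * hg + C Complex.I * map Complex.ofRealHom Q * h2

theorem cj_cj (t : CT) : cj (cj t) = t := by
  obtain ⟨p, rfl⟩ := Ideal.Quotient.mk_surjective t
  rw [cj_mk, cj_mk, map_map]
  congr 1
  have : (starRingEnd ℂ).comp (starRingEnd ℂ) = RingHom.id ℂ := by ext; simp
  rw [this, map_id]

theorem cj_rc (s : RS) : cj (rc s) = rc s := by
  obtain ⟨p, rfl⟩ := Ideal.Quotient.mk_surjective s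
  rw [rc_mk, cj_mk, conj_real]

theorem cj_alg (z : ℂ) : cj (algebraMap ℂ CT z) = algebraMap ℂ CT (conj z) := by
  change cj (Ideal.Quotient.mk _ (C z)) = Ideal.Quotient.mk _ (C (conj z))
  rw [cj_mk, map_C]

theorem main_RS (a : Matrix (Fin 8) (Fin 5) RS) (h : a * a.transpose = 0) :
    ∃ (u : Fin 8 → RS) (q : Fin 5 → RS), ∀ i s, a i s = u i * q s := by
  obtain ⟨u, q, hu, hq, hb⟩ := factor cj cj_cj cj_alg ct_unit (fun i s => rc (a i s))
    (fun i s => cj_rc _) (minors cj cj_cj cj_alg ct_unit _ (fun i s => cj_rc _) (by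
      intro i j
      have := congrFun (congrFun h i) j
      rw [Matrix.mul_apply] at this
      simp only [Matrix.transpose_apply, Matrix.zero_apply] at this
      simp only [← map_mul, ← map_sum, this, map_zero]))
  choose u' hu' using fun i => rc_fixed _ (hu i)
  choose q' hq' using fun i => rc_fixed _ (hq i)
  refine ⟨u', q', fun i s => rc_inj ?_⟩
  rw [map_mul, hu', hq', hb]

end

theorem stmt11
    (a : Matrix (Fin 8) (Fin 5) (MvPolynomial (Fin 8) ℝ ⧸
      Ideal.span {(∑ i : Fin 8, MvPolynomial.X i ^ 2 : MvPolynomial (Fin 8) ℝ)}))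
    (h : a * a.transpose = 0) :
    ∃ (u : Fin 8 → (MvPolynomial (Fin 8) ℝ ⧸
        Ideal.span {(∑ i : Fin 8, MvPolynomial.X i ^ 2 : MvPolynomial (Fin 8) ℝ)}))
      (q : Fin 5 → (MvPolynomial (Fin 8) ℝ ⧸
        Ideal.span {(∑ i : Fin 8, MvPolynomial.X i ^ 2 : MvPolynomial (Fin 8) ℝ)})),
      ∀ i s, a i s = u i * q s := by
  exact main_RS a h
end
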